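/- Let p > 3 be a prime and let a be a positive integer. Then (T_{p^a} − T_{p^{a−1}})/p^{2a} is a p-adic integer and (T_{p^a} − T_{p^{a−1}})/p^{2a} ≡ (1/6) · (p/3)^a · B_{p−2}(1/3) (mod p), i.e., the p-adic valuation of (T_{p^a} − T_{p^{a−1}})/p^{2a} − (1/6)(p/3)^a B_{p−2}(1/3) is at least 1. -/

import Mathlib

/-- The central trinomial coefficient: the coefficient of `x^n` in `(x^2+x+1)^n`. -/
def centralTrinomial (n : ℕ) : ℕ :=
  ∑ k ∈ Finset.range (n / 2 + 1), Nat.choose n (2 * k) * Nat.choose (2 * k) k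

/-- `χ(k) = 1` if `3 ∤ k` and `-2` if `3 ∣ k`. -/
def chi (k : ℕ) : ℤ := if 3 ∣ k then -2 else 1

lemma norm_bernoulli' (p : ℕ) [hp : Fact p.Prime] (n : ℕ) (hn : n + 1 < p) :
    ‖((bernoulli' n : ℚ) : ℚ_[p])‖ ≤ 1 := by
  induction n using Nat.strong_induction_on with
  | _ n ih =>
    have key : ∀ x : ℚ_[p], ‖x‖ ≤ 1 ↔ x ∈ PadicInt.subring p := fun x => Iff.rfl
    rw [bernoulli'_def]
    push_cast
    rw [key]
    refine sub_mem (one_mem _) (sum_mem fun k hk => ?_)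
    have hk' := Finset.mem_range.1 hk
    refine mul_mem ?_ ((key _).1 (ih k hk' (by omega)))
    rw [← key, norm_div]
    have h1 : ((n : ℚ_[p]) - k + 1) = ((n - k + 1 : ℕ) : ℚ_[p]) := by
      push_cast [Nat.cast_sub hk'.le]; ring
    have h2 : ‖((n - k + 1 : ℕ) : ℚ_[p])‖ = 1 := by
      rw [Padic.norm_natCast_eq_one_iff]
      exact (Nat.Prime.coprime_iff_not_dvd hp.1).2
        (fun hd => absurd (Nat.le_of_dvd (by omega) hd) (by omega))
    rw [h1, h2, div_one]
    exact_mod_cast Padic.norm_int_le_one (p := p) (n.choose k : ℤ)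

lemma bernPoly (p : ℕ) [hp : Fact p.Prime] (hp3 : 3 < p) :
    ∃ b : Polynomial ℤ_[p], b.map (PadicInt.Coe.ringHom) =
      (Polynomial.bernoulli (p - 2)).map (algebraMap ℚ ℚ_[p]) := by
  rw [← Polynomial.mem_lifts, Polynomial.lifts_iff_coeff_lifts]
  intro k
  have : ‖((Polynomial.bernoulli (p - 2)).map (algebraMap ℚ ℚ_[p])).coeff k‖ ≤ 1 := by
    rw [Polynomial.coeff_map, Polynomial.coeff_bernoulli]
    split_ifs with h
    swap
    · simp
    · rw [map_mul, norm_mul]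
      refine mul_le_one₀ ?_ (norm_nonneg _) ?_
      · rw [bernoulli, map_mul, norm_mul]
        simp only [map_pow, map_neg, map_one, norm_pow, norm_neg, norm_one, one_pow, one_mul]
        exact norm_bernoulli' p _ (by omega)
      · rw [map_natCast]
        exact_mod_cast Padic.norm_int_le_one (p := p) ((p-2).choose k : ℤ)
  exact ⟨⟨_, this⟩, rfl⟩

lemma bernZ (p : ℕ) [hp : Fact p.Prime] (hp3 : 3 < p) :
    ∃ β : ℤ_[p], (β : ℚ_[p]) = (((Polynomial.bernoulli (p - 2)).eval (1 / 3 : ℚ) : ℚ) : ℚ_[p]) ∧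
    ∃ b : Polynomial (ZMod p),
      (∀ N : ℕ, b.eval (N : ZMod p) - b.eval 0 = -2 * ∑ k ∈ Finset.range N, (k : ZMod p) ^ (p - 3)) ∧
      b.eval 3⁻¹ = PadicInt.toZMod β ∧ b.eval (1 - 3⁻¹) = - PadicInt.toZMod β := by
  obtain ⟨b, hb⟩ := bernPoly p hp3
  have h3 : ‖((1/3 : ℚ) : ℚ_[p])‖ ≤ 1 := by
    have h2 : ‖((3 : ℕ) : ℚ_[p])‖ = 1 := by
      rw [Padic.norm_natCast_eq_one_iff]
      exact (Nat.Prime.coprime_iff_not_dvd hp.1).2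
        (fun hd => absurd (Nat.le_of_dvd (by omega) hd) (by omega))
    push_cast
    rw [norm_div, norm_one]
    push_cast at h2
    rw [h2]; norm_num
  set t : ℤ_[p] := ⟨_, h3⟩ with ht
  have htc : (t : ℚ_[p]) = ((1/3 : ℚ) : ℚ_[p]) := rfl
  have ht3 : 3 * t = 1 := by
    apply PadicInt.ext
    rw [PadicInt.coe_mul, htc, PadicInt.coe_one, show ((3 : ℤ_[p]) : ℚ_[p]) = 3 from map_ofNat PadicInt.Coe.ringHom 3]
    push_cast
    norm_num
  have ht3' : PadicInt.toZMod t = (3 : ZMod p)⁻¹ := by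
    have := congrArg PadicInt.toZMod ht3
    rw [map_mul, map_one, map_ofNat] at this
    exact eq_inv_of_mul_eq_one_right this
  have ev : ∀ (x : ℤ_[p]) (r : ℚ), (x : ℚ_[p]) = (r : ℚ_[p]) →
      ((b.eval x : ℤ_[p]) : ℚ_[p]) = (((Polynomial.bernoulli (p - 2)).eval r : ℚ) : ℚ_[p]) := by
    intro x r hxr
    have h1 : ((b.eval x : ℤ_[p]) : ℚ_[p]) = (b.map PadicInt.Coe.ringHom).eval (x : ℚ_[p]) :=
      (Polynomial.eval_map_apply (PadicInt.Coe.ringHom (p := p)) x).symm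
    rw [h1, hb, hxr]
    exact Polynomial.eval_map_apply (algebraMap ℚ ℚ_[p]) r
  have evm : ∀ x : ℤ_[p], (b.map PadicInt.toZMod).eval (PadicInt.toZMod x) =
      PadicInt.toZMod (b.eval x) := fun x => Polynomial.eval_map_apply _ _
  refine ⟨b.eval t, ev t _ htc, b.map PadicInt.toZMod, ?_, ?_, ?_⟩
  · intro N
    have h := Polynomial.sum_range_pow_eq_bernoulli_sub N (p - 3)
    have hpp : p - 3 + 1 = p - 2 := by omega
    have hpq : ((p - 3 : ℕ) : ℚ) + 1 = ((p - 2 : ℕ) : ℚ) := by exact_mod_cast hpp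
    rw [Nat.succ_eq_add_one, hpp, hpq, ← Polynomial.bernoulli_eval_zero] at h
    have hz : b.eval (N : ℤ_[p]) - b.eval 0 = ((p - 2 : ℕ) : ℤ_[p]) *
        ∑ k ∈ Finset.range N, (k : ℤ_[p]) ^ (p - 3) := by
      apply PadicInt.ext
      rw [PadicInt.coe_sub, ev (N : ℤ_[p]) N (by simp), ev 0 0 (by simp), ← Rat.cast_sub, ← h]
      push_cast [PadicInt.coe_sum]
      rfl
    have := congrArg PadicInt.toZMod hz
    rw [map_sub, ← evm, ← evm, map_mul, map_natCast, map_sum, map_natCast] at this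
    simp only [map_zero, map_pow, map_natCast] at this
    rw [this, Nat.cast_sub (by omega)]
    simp
  · rw [← ht3', evm]
  · rw [← ht3', ← map_one PadicInt.toZMod, ← map_sub, evm, ← map_neg]
    congr 1
    apply PadicInt.ext
    rw [ev (1 - t) (1 - 1/3) (by push_cast [htc]; rfl), PadicInt.coe_neg, ev t _ htc,
      Polynomial.bernoulli_eval_one_sub]
    have : Odd (p - 2) := by
      have := hp.1.eq_two_or_odd'
      rcases this with h | ⟨k, h⟩
      · omega
      · exact ⟨k - 1, by omega⟩
    rw [this.neg_one_pow]
    push_cast; ring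

lemma sum_res (M : Type*) [AddCommMonoid M] (g : ℕ → M) (q : ℕ) :
    ∑ i ∈ Finset.range (3 * q + 2), (if i % 3 = 2 then g i else 0)
      = ∑ t ∈ Finset.range q, g (3 * t + 2) := by
  induction q with
  | zero => simp [Finset.sum_range_succ]
  | succ q ih =>
    rw [show 3 * (q + 1) + 2 = 3 * q + 2 + 1 + 1 + 1 by ring, Finset.sum_range_succ,
      Finset.sum_range_succ, Finset.sum_range_succ, ih, Finset.sum_range_succ,
      if_pos (by omega), if_neg (by omega), if_neg (by omega)]
    simp

lemma sum_res' (M : Type*) [AddCommMonoid M] (g : ℕ → M) (q : ℕ) :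
    ∑ i ∈ Finset.range (3 * q + 3), (if i % 3 = 1 then g i else 0)
      = ∑ t ∈ Finset.range (q + 1), g (3 * t + 1) := by
  induction q with
  | zero => simp [Finset.sum_range_succ]
  | succ q ih =>
    rw [show 3 * (q + 1) + 3 = 3 * q + 3 + 1 + 1 + 1 by ring, Finset.sum_range_succ,
      Finset.sum_range_succ, Finset.sum_range_succ, ih, Finset.sum_range_succ _ (q + 1),
      if_neg (by omega), if_pos (by omega), if_neg (by omega)]
    simp [show 3 * (q + 1) = 3 * q + 3 by ring]

lemma sumFinal (p : ℕ) [hp : Fact p.Prime] (hp3 : 3 < p) (b : Polynomial (ZMod p)) (β : ZMod p)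
    (hb : ∀ N : ℕ, b.eval (N : ZMod p) - b.eval 0 =
      -2 * ∑ k ∈ Finset.range N, (k : ZMod p) ^ (p - 3))
    (hb1 : b.eval 3⁻¹ = β) (hb2 : b.eval (1 - 3⁻¹) = - β)
    (n : ℕ) (hn : (n : ZMod p) = 0) (ε : ℤ)
    (hε : (n % 3 = 1 ∧ ε = 1) ∨ (n % 3 = 2 ∧ ε = -1)) :
    3 * ∑ i ∈ Finset.range (n + 1), ((chi i * chi (n - i) : ℤ) : ZMod p) * (i : ZMod p) ^ (p - 3)
      = - (ε * β) := by
  have h2 : (2 : ZMod p) ≠ 0 := by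
    intro h
    have := (ZMod.natCast_eq_zero_iff 2 p).1 (by exact_mod_cast h)
    exact absurd (Nat.le_of_dvd (by norm_num) this) (by omega)
  have h3 : (3 : ZMod p) ≠ 0 := by
    intro h
    have := (ZMod.natCast_eq_zero_iff 3 p).1 (by exact_mod_cast h)
    exact absurd (Nat.le_of_dvd (by norm_num) this) (by omega)
  have h9 : (9 : ZMod p) * 3 ^ (p - 3) = 1 := by
    have := ZMod.pow_card_sub_one_eq_one h3
    rw [show p - 1 = p - 3 + 2 by omega, pow_add] at this
    linear_combination this
  -- total sum vanishes
  have htot : ∑ i ∈ Finset.range (n + 1), (i : ZMod p) ^ (p - 3) = 0 := by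
    rw [Finset.sum_range_succ, hn, zero_pow (by omega), add_zero]
    have := hb n
    rw [hn, sub_self] at this
    rcases mul_eq_zero.1 this.symm with h | h
    · exact absurd (neg_eq_zero.1 h) h2
    · exact h
  have hIco : ∀ u v : ℕ, -2 * ∑ t ∈ Finset.range v, ((t + u : ℕ) : ZMod p) ^ (p - 3) =
      b.eval ((u + v : ℕ) : ZMod p) - b.eval (u : ZMod p) := by
    intro u v
    have e1 := hb (u + v)
    have e2 := hb u
    rw [Finset.sum_range_add] at e1
    simp only [add_comm _ u]
    linear_combination e2 - e1
  have hscale : ∀ (r u v : ℕ), (r : ZMod p) = 3 * u →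
      9 * ∑ t ∈ Finset.range v, ((3 * t + r : ℕ) : ZMod p) ^ (p - 3) =
        ∑ t ∈ Finset.range v, ((t + u : ℕ) : ZMod p) ^ (p - 3) := by
    intro r u v hr
    rw [Finset.mul_sum]
    refine Finset.sum_congr rfl fun t _ => ?_
    push_cast
    rw [hr, ← mul_add, mul_pow, ← mul_assoc, h9, one_mul]
  rcases hε with ⟨hm, rfl⟩ | ⟨hm, rfl⟩
  · obtain ⟨q, rfl⟩ : ∃ q, n = 3 * q + 1 := ⟨n / 3, by omega⟩
    have hs : ∀ i ∈ Finset.range (3 * q + 1 + 1),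
        ((chi i * chi (3 * q + 1 - i) : ℤ) : ZMod p) * (i : ZMod p) ^ (p - 3) =
        -2 * (i : ZMod p) ^ (p - 3) + 3 * (if i % 3 = 2 then (i : ZMod p) ^ (p - 3) else 0) := by
      intro i hi
      have := Finset.mem_range.1 hi
      have hc : chi i * chi (3 * q + 1 - i) = if i % 3 = 2 then 1 else -2 := by
        unfold chi
        split_ifs <;> omega
      rw [hc]
      split_ifs <;> push_cast <;> ring
    rw [Finset.sum_congr rfl hs, Finset.sum_add_distrib, ← Finset.mul_sum, ← Finset.mul_sum, htot,
      sum_res]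
    push_cast at hn
    have e1 := hscale 2 (q + 1) q (by push_cast; linear_combination -hn)
    have e2 := hIco (q + 1) q
    have e3 : ((q + 1 + q : ℕ) : ZMod p) = 3⁻¹ := by
      push_cast; field_simp; linear_combination 2 * hn
    have e4 : ((q + 1 : ℕ) : ZMod p) = 1 - 3⁻¹ := by
      push_cast; field_simp; linear_combination hn
    rw [e3, hb1, e4, hb2] at e2
    apply mul_left_cancel₀ h2
    push_cast
    push_cast at e1 e2
    linear_combination 2 * e1 - e2
  · obtain ⟨q, rfl⟩ : ∃ q, n = 3 * q + 2 := ⟨n / 3, by omega⟩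
    have hs : ∀ i ∈ Finset.range (3 * q + 2 + 1),
        ((chi i * chi (3 * q + 2 - i) : ℤ) : ZMod p) * (i : ZMod p) ^ (p - 3) =
        -2 * (i : ZMod p) ^ (p - 3) + 3 * (if i % 3 = 1 then (i : ZMod p) ^ (p - 3) else 0) := by
      intro i hi
      have := Finset.mem_range.1 hi
      have hc : chi i * chi (3 * q + 2 - i) = if i % 3 = 1 then 1 else -2 := by
        unfold chi
        split_ifs <;> omega
      rw [hc]
      split_ifs <;> push_cast <;> ring
    rw [Finset.sum_congr rfl hs, Finset.sum_add_distrib, ← Finset.mul_sum, ← Finset.mul_sum, htot,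
      sum_res']
    push_cast at hn
    have e1 := hscale 1 (q + 1) (q + 1) (by push_cast; linear_combination -hn)
    have e2 := hIco (q + 1) (q + 1)
    have e3 : ((q + 1 + (q + 1) : ℕ) : ZMod p) = 1 - 3⁻¹ := by
      push_cast; field_simp; linear_combination 2 * hn
    have e4 : ((q + 1 : ℕ) : ZMod p) = 3⁻¹ := by
      push_cast; field_simp; linear_combination hn
    rw [e3, hb2, e4, hb1] at e2
    apply mul_left_cancel₀ h2
    push_cast
    push_cast at e1 e2
    linear_combination 2 * e1 - e2
open PowerSeries in
lemma sum_even (M : Type*) [AddCommMonoid M] (g : ℕ → M) (n : ℕ) (hg : ∀ k, Odd k → g k = 0) :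
    ∑ k ∈ Finset.range (n + 1), g k = ∑ k ∈ Finset.range (n / 2 + 1), g (2 * k) := by
  induction n with
  | zero => simp
  | succ n ih =>
    rw [Finset.sum_range_succ, ih]
    rcases Nat.even_or_odd' n with ⟨k, rfl | rfl⟩
    · rw [hg (2 * k + 1) ⟨k, rfl⟩, add_zero]
      congr 2
      omega
    · rw [show (2 * k + 1) / 2 = k by omega, show (2 * k + 1 + 1) / 2 = k + 1 by omega,
        Finset.sum_range_succ _ (k + 1)]
      rfl

lemma coeff_one_add_sq (j : ℕ) :
    ((1 + Polynomial.X ^ 2 : Polynomial ℕ) ^ j).coeff j = if Even j then j.choose (j / 2) else 0 := by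
  have : (1 + Polynomial.X ^ 2 : Polynomial ℕ) ^ j =
      Polynomial.expand ℕ 2 ((1 + Polynomial.X) ^ j) := by simp
  rw [this, Polynomial.coeff_expand (by norm_num), Polynomial.coeff_one_add_X_pow]
  simp [even_iff_two_dvd]

lemma trinomial_coeff_nat (n : ℕ) :
    ((1 + Polynomial.X + Polynomial.X ^ 2 : Polynomial ℕ) ^ n).coeff n = centralTrinomial n := by
  have h : (1 + Polynomial.X + Polynomial.X ^ 2 : Polynomial ℕ) =
    (1 + Polynomial.X ^ 2) + Polynomial.X := by ring
  rw [h, add_pow, Polynomial.finsetSum_coeff, centralTrinomial]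
  have : ∀ k ∈ Finset.range (n + 1),
      ((1 + Polynomial.X ^ 2 : Polynomial ℕ) ^ k * Polynomial.X ^ (n - k) *
        ((n.choose k : ℕ) : Polynomial ℕ)).coeff n =
      n.choose k * if Even k then k.choose (k / 2) else 0 := by
    intro k hk
    have hk' := Finset.mem_range.1 hk
    rw [Polynomial.coeff_mul_natCast]
    have : n = k + (n - k) := by omega
    conv_lhs => arg 1; rw [this]
    rw [show k + (n - k) - k = n - k by omega, Polynomial.coeff_mul_X_pow, coeff_one_add_sq]
    simp [mul_comm]
  rw [Finset.sum_congr rfl this, sum_even]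
  · simp
  · intro k hk
    simp [Nat.not_even_iff_odd.2 hk]

open PowerSeries

/-- `1 + X + X^2` -/
noncomputable def FF (R : Type*) [CommRing R] : R⟦X⟧ := 1 + X + X ^ 2

/-- `1 + X^p + X^(2p)` -/
noncomputable def FP (R : Type*) [CommRing R] (p : ℕ) : R⟦X⟧ := 1 + X ^ p + (X ^ p) ^ 2

lemma FP_eq (R : Type*) [CommRing R] (p : ℕ) (hp : p ≠ 0) : FP R p = expand p hp (FF R) := by
  simp [FP, FF]

lemma trinomial_coeff (R : Type*) [CommRing R] (n : ℕ) :
    coeff n ((FF R) ^ n) = centralTrinomial n := by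
  have h : (FF R) ^ n = (((1 + Polynomial.X + Polynomial.X ^ 2 : Polynomial ℕ) ^ n).map
      (Nat.castRingHom R) : Polynomial R) := by
    simp [FF]
  rw [h, Polynomial.coeff_coe, Polynomial.coeff_map, trinomial_coeff_nat]
  simp

noncomputable def UU (R : Type*) [CommRing R] : R⟦X⟧ := mk fun k => (chi (k + 1) : R)

noncomputable def VV (R : Type*) [CommRing R] (p : ℕ) : R⟦X⟧ :=
  mk fun k => if p ∣ k + 1 then (chi (k + 1) : R) else 0

lemma UU_mul (R : Type*) [CommRing R] : UU R * FF R = 1 + 2 * X := by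
  ext k
  have : UU R * FF R = UU R + UU R * X + UU R * X ^ 2 := by rw [FF]; ring
  rw [this, map_add, map_add]
  have h2 : (1 + 2 * X : R⟦X⟧) = 1 + C (2 : R) * X := by
    rw [map_ofNat]
  rw [h2]
  rcases k with _ | _ | k
  · simp [UU, chi, coeff_mul_X_pow']
  · rw [show (0 + 1 : ℕ) = 0 + 1 from rfl, coeff_succ_mul_X]
    simp [UU, chi, coeff_mul_X_pow', coeff_one]
    norm_num
  · rw [show k + 1 + 1 = k + 2 from rfl, coeff_mul_X_pow, coeff_succ_mul_X, map_add, coeff_C_mul]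
    simp only [UU, coeff_mk, coeff_one, coeff_X]
    have : chi (k + 1 + 1 + 1) + chi (k + 1 + 1) + chi (k + 1) = 0 := by
      unfold chi; split_ifs <;> omega
    rw [← Int.cast_add, ← Int.cast_add, this]
    simp

lemma chi_mul (p s : ℕ) (hp : Nat.Coprime p 3) : chi (p * s) = chi s := by
  unfold chi
  have : 3 ∣ p * s ↔ 3 ∣ s := hp.symm.dvd_mul_left
  simp [this]

lemma VV_eq (R : Type*) [CommRing R] (p : ℕ) (hp : p ≠ 0) (hp3 : Nat.Coprime p 3) :
    VV R p = X ^ (p - 1) * expand p hp (UU R) := by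
  ext k
  rw [coeff_X_pow_mul', VV, coeff_mk]
  by_cases h : p ∣ k + 1
  · obtain ⟨s, hs⟩ := h
    have hs0 : s ≠ 0 := by rintro rfl; omega
    obtain ⟨s, rfl⟩ := Nat.exists_eq_succ_of_ne_zero hs0
    have hk : k = p * s + (p - 1) := by
      rw [Nat.succ_eq_add_one, mul_add] at hs; omega
    rw [if_pos ⟨_, hs⟩, if_pos (by omega), hs, chi_mul _ _ hp3, hk, Nat.add_sub_cancel,
      coeff_expand_mul]
    simp [UU]
  · rw [if_neg h]
    split_ifs with h1
    · rw [coeff_expand_of_not_dvd]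
      intro h2
      apply h
      have := Nat.dvd_add h2 (dvd_refl p)
      rwa [show k - (p - 1) + p = k + 1 by omega] at this
    · rfl

lemma VV_mul (R : Type*) [CommRing R] (p : ℕ) (hp : p ≠ 0) (hp3 : Nat.Coprime p 3) :
    VV R p * FP R p = X ^ (p - 1) * (1 + 2 * X ^ p) := by
  rw [VV_eq R p hp hp3, FP_eq R p hp, mul_assoc, ← map_mul, UU_mul]
  rw [map_add, map_mul, map_ofNat, map_one, expand_X]

lemma dFF (R : Type*) [CommRing R] : d⁄dX R (FF R) = UU R * FF R := by
  rw [UU_mul, FF]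
  simp

lemma dFP (R : Type*) [CommRing R] (p : ℕ) (hp : p ≠ 0) (hp3 : Nat.Coprime p 3) :
    d⁄dX R (FP R p) = (p : R⟦X⟧) * VV R p * FP R p := by
  rw [mul_assoc, VV_mul R p hp hp3, FP]
  simp
  ring

lemma ode_unique (K : Type*) [Field K] [CharZero K] (D g s : K⟦X⟧) (N : ℕ)
    (h0 : constantCoeff D = 0) (h : d⁄dX K D = g * D + X ^ N * s) : X ^ (N + 1) ∣ D := by
  have : ∀ j ≤ N + 1, X ^ j ∣ D := by
    intro j
    induction j with
    | zero => intro _; simp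
    | succ j ih =>
      intro hj
      obtain ⟨e, he⟩ := ih (by omega)
      rw [X_pow_dvd_iff] 
      intro m hm
      by_cases hmj : m < j
      · exact (X_pow_dvd_iff.1 ⟨e, he⟩) m hmj
      obtain rfl : m = j := by omega
      rcases m with _ | m
      · simpa using h0
      · have hd : X ^ (m + 1) ∣ d⁄dX K D := by
          rw [h]
          refine dvd_add (Dvd.dvd.mul_left ⟨e, he⟩ _) (Dvd.dvd.mul_right ?_ _)
          exact pow_dvd_pow _ (by omega)
        have := (X_pow_dvd_iff.1 hd) m (by omega)
        rw [coeff_derivative] at this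
        rcases mul_eq_zero.1 this with h | h
        · exact h
        · exact absurd h (by exact_mod_cast Nat.succ_ne_zero m)
  exact this _ le_rfl

/-- truncated exponential -/
noncomputable def ee (K : Type*) [Field K] (n : ℕ) (h : K⟦X⟧) (N : ℕ) : K⟦X⟧ :=
  ∑ i ∈ Finset.range (N + 1), C ((n : K) ^ i / (i.factorial : K)) * h ^ i

lemma d_ee (K : Type*) [Field K] [CharZero K] (n : ℕ) (h : K⟦X⟧) (N : ℕ) :
    d⁄dX K (ee K n h N) = (n : K⟦X⟧) * d⁄dX K h *
      (ee K n h N - C ((n : K) ^ N / (N.factorial : K)) * h ^ N) := by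
  induction N with
  | zero => simp [ee]
  | succ N ih =>
    have : ee K n h (N + 1) = ee K n h N +
      C ((n : K) ^ (N + 1) / ((N + 1).factorial : K)) * h ^ (N + 1) := by
      rw [ee, Finset.sum_range_succ]; rfl
    rw [this, map_add, ih, Derivation.leibniz, derivative_C, derivative_pow]
    have hc : C ((n : K) ^ (N + 1) / ((N + 1).factorial : K)) * ((N : K⟦X⟧) + 1) =
        (n : K⟦X⟧) * C ((n : K) ^ N / (N.factorial : K)) := by
      have h1 : ((N : K⟦X⟧) + 1) = C ((N : K) + 1) := by simp
      have h2 : (n : K⟦X⟧) = C (n : K) := by simp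
      rw [h1, h2, ← map_mul, ← map_mul]
      congr 1
      have : ((N : K) + 1) ≠ 0 := by exact_mod_cast Nat.succ_ne_zero N
      have : (N.factorial : K) ≠ 0 := by exact_mod_cast N.factorial_ne_zero
      rw [Nat.factorial_succ]
      push_cast
      field_simp
      ring
    simp only [smul_eq_mul, mul_zero, add_zero, Nat.add_sub_cancel]
    push_cast
    linear_combination (h ^ N * d⁄dX K h) * hc

lemma expansion (K : Type*) [Field K] [CharZero K] (p m : ℕ) (hp : p ≠ 0) (hp3 : Nat.Coprime p 3)
    (h : K⟦X⟧) (h0 : constantCoeff h = 0) (hh : d⁄dX K h = UU K - VV K p) (N : ℕ) :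
    X ^ (N + 1) ∣ (FF K) ^ (p * m) - (FP K p) ^ m * ee K (p * m) h N := by
  obtain ⟨h1, hh1⟩ := X_dvd_iff.2 h0
  have dpow : ∀ (f g : K⟦X⟧) (k : ℕ), d⁄dX K f = g * f → d⁄dX K (f ^ k) = k * g * f ^ k := by
    intro f g k hf
    rw [derivative_pow, hf]
    rcases k with _ | k
    · simp
    · rw [Nat.add_sub_cancel]; ring
  refine ode_unique K _ (((p * m : ℕ) : K⟦X⟧) * UU K)
    (((p * m : ℕ) : K⟦X⟧) * d⁄dX K h * (FP K p) ^ m *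
      C (((p * m : ℕ) : K) ^ N / (N.factorial : K)) * h1 ^ N) N ?_ ?_
  · simp only [map_sub, map_pow, map_mul]
    have e1 : constantCoeff (FF K) = 1 := by simp [FF]
    have e2 : constantCoeff (FP K p) = 1 := by simp [FP, hp]
    have e3 : constantCoeff (ee K (p * m) h N) = 1 := by
      rw [ee, map_sum, Finset.sum_range_succ']
      simp [h0]
    rw [e1, e2, e3]; simp
  · rw [map_sub, Derivation.leibniz, d_ee, dpow _ _ _ (dFF K), dpow _ _ _ (dFP K p hp hp3), hh]
    have : h ^ N = X ^ N * h1 ^ N := by rw [hh1, mul_pow]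
    rw [this]
    simp only [smul_eq_mul]
    push_cast
    ring

lemma factorial_norm (p : ℕ) [hp : Fact p.Prime] (hp3 : 3 < p) (a i : ℕ) (ha : 0 < a) (hi : 3 ≤ i) :
    ‖((p ^ a : ℕ) : ℚ_[p]) ^ i / (i.factorial : ℚ_[p])‖ ≤ ((p : ℝ)⁻¹) ^ (2 * a + 1) := by
  have hp5 : 5 ≤ p := by
    rcases Nat.lt_or_ge 4 p with h | h
    · exact h
    · obtain rfl : p = 4 := by omega
      exact absurd hp.1 (by norm_num)
  obtain ⟨v, u, hu, huv⟩ := Nat.exists_eq_pow_mul_and_not_dvd i.factorial_ne_zero p hp.1.ne_one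
  have hv : v + 3 ≤ i := by
    have h1 : v ≤ padicValNat p i.factorial :=
      (padicValNat_dvd_iff_le i.factorial_ne_zero).1 ⟨u, huv⟩
    have h2 := sub_one_mul_padicValNat_factorial_lt_of_ne_zero (p := p) (n := i) (by omega)
    have h3 : 4 * padicValNat p i.factorial ≤ (p - 1) * padicValNat p i.factorial :=
      Nat.mul_le_mul_right _ (by omega)
    omega
  have hp0 : (p : ℚ_[p]) ≠ 0 := by exact_mod_cast hp.1.ne_zero
  have hexp : v + (2 * a + 1) ≤ a * i := by
    obtain ⟨j, rfl⟩ : ∃ j, i = j + 3 := ⟨i - 3, by omega⟩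
    nlinarith
  obtain ⟨r, hr⟩ : ∃ r, a * i = v + (2 * a + 1) + r := ⟨_, (Nat.add_sub_of_le hexp).symm⟩
  have hu1 : ‖(u : ℚ_[p])‖ = 1 := by
    rw [Padic.norm_natCast_eq_one_iff]
    exact (Nat.Prime.coprime_iff_not_dvd hp.1).2 hu
  have hu0 : (u : ℚ_[p]) ≠ 0 := by
    intro h; rw [h] at hu1; simp at hu1
  have : ((p ^ a : ℕ) : ℚ_[p]) ^ i / (i.factorial : ℚ_[p]) =
      (p : ℚ_[p]) ^ (2 * a + 1) * (p : ℚ_[p]) ^ r / (u : ℚ_[p]) := by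
    rw [huv]
    push_cast
    rw [← pow_mul, hr, pow_add, pow_add]
    field_simp
  rw [this, norm_div, hu1, div_one, norm_mul, norm_pow, norm_pow, Padic.norm_p]
  refine mul_le_of_le_one_right (by positivity) (pow_le_one₀ (by positivity) ?_)
  exact inv_le_one_of_one_le₀ (by exact_mod_cast hp.1.one_le)

noncomputable def hQ (p : ℕ) [Fact p.Prime] : ℚ_[p]⟦X⟧ :=
  mk fun k => if p ∣ k then 0 else (chi k : ℚ_[p]) / k

lemma hQ_deriv (p : ℕ) [hp : Fact p.Prime] :
    d⁄dX ℚ_[p] (hQ p) = UU ℚ_[p] - VV ℚ_[p] p := by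
  ext k
  rw [coeff_derivative, map_sub, hQ, UU, VV, coeff_mk, coeff_mk, coeff_mk]
  split_ifs with h
  · simp
  · have : ((k : ℚ_[p]) + 1) ≠ 0 := by exact_mod_cast Nat.succ_ne_zero k
    push_cast
    field_simp
    simp

lemma hQ_lift (p : ℕ) [hp : Fact p.Prime] : ∃ hZ : ℤ_[p]⟦X⟧,
    map (PadicInt.Coe.ringHom) hZ = hQ p ∧
    ∀ k, coeff k (map PadicInt.toZMod hZ) = (chi k : ZMod p) * (k : ZMod p)⁻¹ := by
  have key : ∀ k : ℕ, ∃ c : ℤ_[p], (c : ℚ_[p]) = (if p ∣ k then 0 else (chi k : ℚ_[p]) / k) ∧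
      PadicInt.toZMod c = (chi k : ZMod p) * (k : ZMod p)⁻¹ := by
    intro k
    split_ifs with h
    · refine ⟨0, by simp, ?_⟩
      rw [(ZMod.natCast_eq_zero_iff k p).2 h]; simp
    · have hk1 : ‖(k : ℚ_[p])‖ = 1 := by
        rw [Padic.norm_natCast_eq_one_iff]
        exact (Nat.Prime.coprime_iff_not_dvd hp.1).2 h
      have hk0 : (k : ℚ_[p]) ≠ 0 := by
        intro h; rw [h] at hk1; simp at hk1
      have hn : ‖(chi k : ℚ_[p]) / k‖ ≤ 1 := by
        rw [norm_div, hk1, div_one]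
        exact Padic.norm_int_le_one _
      refine ⟨⟨_, hn⟩, rfl, ?_⟩
      have hk2 : (k : ZMod p) ≠ 0 := fun h' => h ((ZMod.natCast_eq_zero_iff k p).1 h')
      rw [← div_eq_mul_inv, eq_div_iff hk2]
      have e : (show ℤ_[p] from ⟨_, hn⟩) * (k : ℤ_[p]) = (chi k : ℤ_[p]) := by
        apply PadicInt.ext
        rw [PadicInt.coe_mul, PadicInt.coe_natCast, PadicInt.coe_intCast]
        exact div_mul_cancel₀ _ hk0
      have := congrArg PadicInt.toZMod e
      rwa [map_mul, map_natCast, map_intCast] at this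
  choose c hc1 hc2 using key
  refine ⟨mk c, ?_, ?_⟩
  · ext k
    rw [coeff_map, coeff_mk, hQ, coeff_mk]
    exact hc1 k
  · intro k
    rw [coeff_map, coeff_mk, hc2]

lemma coeff_mid (p : ℕ) [hp : Fact p.Prime] (hp3 : 3 < p) (a : ℕ) (hZ : ℤ_[p]⟦X⟧)
    (hc : ∀ k, coeff k (map PadicInt.toZMod hZ) = (chi k : ZMod p) * (k : ZMod p)⁻¹) :
    PadicInt.toZMod (coeff (p ^ (a + 1)) (FP ℤ_[p] p ^ (p ^ a) * hZ ^ 2)) =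
      - ∑ i ∈ Finset.range (p ^ (a + 1) + 1),
        ((chi i * chi (p ^ (a + 1) - i) : ℤ) : ZMod p) * (i : ZMod p) ^ (p - 3) := by
  set n := p ^ (a + 1) with hn
  have hn0 : (n : ZMod p) = 0 := by rw [hn]; push_cast; simp
  have hnpos : 0 < n := pow_pos hp.1.pos _
  rw [← coeff_map, map_mul, map_pow, map_pow]
  have hF : map PadicInt.toZMod (FP ℤ_[p] p) ^ (p ^ a) = 1 + X ^ n + X ^ n * X ^ n := by
    have : CharP (ZMod p)⟦X⟧ p := charP_of_injective_ringHom
      (f := (C : ZMod p →+* (ZMod p)⟦X⟧)) C_injective p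
    have : map PadicInt.toZMod (FP ℤ_[p] p) = 1 + X ^ p + (X ^ p) ^ 2 := by
      simp [FP]
    rw [this, add_pow_char_pow, add_pow_char_pow]
    simp only [← pow_mul, ← pow_add, one_pow]
    congr 3
    · rw [hn, pow_succ']
    · rw [hn, pow_succ']; ring
  set g := map PadicInt.toZMod hZ with hg
  have hg0 : constantCoeff g = 0 := by
    rw [← coeff_zero_eq_constantCoeff_apply, hc]; simp
  have hsplit : (1 + X ^ n + X ^ n * X ^ n) * g ^ 2 =
      g ^ 2 + X ^ n * (g ^ 2 + X ^ n * g ^ 2) := by ring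
  rw [hF, hsplit, map_add, coeff_X_pow_mul', if_pos le_rfl, Nat.sub_self, map_add,
    coeff_X_pow_mul', if_neg (by omega), coeff_zero_eq_constantCoeff_apply]
  rw [map_pow (constantCoeff (R := ZMod p)) g 2, hg0, zero_pow (by norm_num), add_zero, add_zero, sq, coeff_mul,
    Finset.Nat.sum_antidiagonal_eq_sum_range_succ (fun i j => coeff i g * coeff j g),
    ← Finset.sum_neg_distrib]
  refine Finset.sum_congr rfl fun i hi => ?_
  have hi' := Finset.mem_range.1 hi
  rw [hc, hc, Nat.cast_sub (by omega), hn0, zero_sub, inv_neg]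
  have : (i : ZMod p) ^ (p - 3) = (i : ZMod p)⁻¹ * (i : ZMod p)⁻¹ := by
    by_cases h0 : (i : ZMod p) = 0
    · rw [h0, zero_pow (by omega)]; simp
    · have := ZMod.pow_card_sub_one_eq_one h0
      rw [show p - 1 = p - 3 + 2 by omega, pow_add] at this
      field_simp
      exact this
  rw [this]
  push_cast
  ring

lemma legendre_pow (p : ℕ) [hp : Fact p.Prime] (hp3 : 3 < p) (a : ℕ) :
    (p ^ a % 3 = 1 ∧ legendreSym 3 p ^ a = 1) ∨ (p ^ a % 3 = 2 ∧ legendreSym 3 p ^ a = -1) := by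
  have h0 : p % 3 ≠ 0 := by
    intro h
    have := (Nat.prime_dvd_prime_iff_eq Nat.prime_three hp.1).1 (Nat.dvd_of_mod_eq_zero h)
    omega
  have h1 : (p % 3 = 1 ∧ legendreSym 3 p = 1) ∨ (p % 3 = 2 ∧ legendreSym 3 p = -1) := by
    rw [legendreSym.mod]
    have : p % 3 = 1 ∨ p % 3 = 2 := by omega
    rcases this with h | h
    · left
      refine ⟨h, ?_⟩
      have : (p : ℤ) % ((3 : ℕ) : ℤ) = 1 := by omega
      rw [this]; decide
    · right
      refine ⟨h, ?_⟩
      have : (p : ℤ) % ((3 : ℕ) : ℤ) = 2 := by omega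
      rw [this]; decide
  induction a with
  | zero => left; simp
  | succ a ih =>
    rw [pow_succ, pow_succ, Nat.mul_mod]
    rcases h1 with ⟨h, h'⟩ | ⟨h, h'⟩ <;> rcases ih with ⟨k, k'⟩ | ⟨k, k'⟩ <;>
      rw [h, k, k', h'] <;> simp

lemma main_expansion (p : ℕ) [hp : Fact p.Prime] (hp3 : 3 < p) (a : ℕ) (hZ : ℤ_[p]⟦X⟧)
    (hZQ : map (PadicInt.Coe.ringHom) hZ = hQ p) :
    ∃ τ : ℚ_[p], ‖τ‖ ≤ ((p : ℝ)⁻¹) ^ (2 * (a + 1) + 1) ∧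
    (centralTrinomial (p ^ (a + 1)) : ℚ_[p]) - centralTrinomial (p ^ a) =
      (p : ℚ_[p]) ^ (2 * (a + 1)) / 2 *
        ((coeff (p ^ (a + 1)) (FP ℤ_[p] p ^ (p ^ a) * hZ ^ 2) : ℤ_[p]) : ℚ_[p]) + τ := by
  have hcop : Nat.Coprime p 3 := by
    rw [Nat.coprime_primes hp.1 Nat.prime_three]; omega
  have hn : p * p ^ a = p ^ (a + 1) := (pow_succ' p a).symm
  set n := p ^ (a + 1) with hndef
  have hh0 : constantCoeff (hQ p) = 0 := by
    rw [← coeff_zero_eq_constantCoeff_apply, hQ, coeff_mk]; simp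
  have hexp := expansion ℚ_[p] p (p ^ a) hp.1.ne_zero hcop (hQ p) hh0 (hQ_deriv p) (n + 2)
  rw [hn] at hexp
  have hco := X_pow_dvd_iff.1 hexp n (by omega)
  rw [map_sub, sub_eq_zero, trinomial_coeff, ee, Finset.mul_sum, map_sum,
    show n + 2 + 1 = 3 + n by ring, Finset.sum_range_add] at hco
  have hcast : ∀ i, coeff n (FP ℚ_[p] p ^ (p ^ a) * hQ p ^ i) =
      ((coeff n (FP ℤ_[p] p ^ (p ^ a) * hZ ^ i) : ℤ_[p]) : ℚ_[p]) := by
    intro i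
    have : FP ℚ_[p] p ^ (p ^ a) * hQ p ^ i =
        map PadicInt.Coe.ringHom (FP ℤ_[p] p ^ (p ^ a) * hZ ^ i) := by
      rw [map_mul, map_pow, map_pow, hZQ]; simp [FP]
    rw [this, coeff_map]; rfl
  have hterm : ∀ i, coeff n (FP ℚ_[p] p ^ (p ^ a) *
      (C ((n : ℚ_[p]) ^ i / (i.factorial : ℚ_[p])) * hQ p ^ i)) =
      (n : ℚ_[p]) ^ i / (i.factorial : ℚ_[p]) * coeff n (FP ℚ_[p] p ^ (p ^ a) * hQ p ^ i) := by
    intro i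
    rw [mul_left_comm, coeff_C_mul]
  simp only [hterm] at hco
  refine ⟨∑ x ∈ Finset.range n, (n : ℚ_[p]) ^ (3 + x) / ((3 + x).factorial : ℚ_[p]) *
    coeff n (FP ℚ_[p] p ^ p ^ a * hQ p ^ (3 + x)), ?_, ?_⟩
  rotate_left
  · rw [hco, Finset.sum_range_succ, Finset.sum_range_succ, Finset.sum_range_succ,
      Finset.sum_range_zero, zero_add, hcast 2]
    have h0 : coeff n (FP ℚ_[p] p ^ (p ^ a) * hQ p ^ 0) =
        (centralTrinomial (p ^ a) : ℚ_[p]) := by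
      rw [pow_zero, mul_one, FP_eq _ p hp.1.ne_zero, ← map_pow, ← hn, coeff_expand_mul,
        trinomial_coeff]
    have h1 : coeff n (FP ℚ_[p] p ^ (p ^ a) * hQ p ^ 1) = 0 := by
      rw [pow_one, FP_eq _ p hp.1.ne_zero, ← map_pow, coeff_mul]
      refine Finset.sum_eq_zero fun x hx => ?_
      have hx' := Finset.HasAntidiagonal.mem_antidiagonal.1 hx
      by_cases hd : p ∣ x.1
      · have : p ∣ x.2 := by
          rw [← hn] at hx'
          exact (Nat.dvd_add_right hd).1 ⟨_, hx'⟩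
        rw [hQ, coeff_mk, if_pos this, mul_zero]
      · rw [coeff_expand_of_not_dvd _ _ _ hd, zero_mul]
    rw [h0, h1]
    have h2 : (n : ℚ_[p]) ^ 2 / ((2 : ℕ).factorial : ℚ_[p]) = (p : ℚ_[p]) ^ (2 * (a + 1)) / 2 := by
      rw [hndef]; push_cast; rw [← pow_mul, mul_comm 2]; simp
    rw [h2]
    simp only [pow_zero, Nat.factorial_zero, Nat.cast_one, div_one, one_mul, mul_zero, add_zero]
    rw [add_assoc, add_sub_cancel_left]
  · refine IsUltrametricDist.norm_sum_le_of_forall_le_of_nonneg (by positivity) fun i _ => ?_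
    rw [norm_mul, hcast]
    refine (mul_le_of_le_one_right (norm_nonneg _) (PadicInt.norm_le_one _)).trans ?_
    exact factorial_norm p hp3 (a + 1) (3 + i) (by omega) (by omega)

theorem trinomial_prime_power_supercongruence (p : ℕ) [hp : Fact p.Prime] (hp3 : 3 < p)
    (a : ℕ) (ha : 0 < a) :
    ‖((((centralTrinomial (p ^ a) : ℚ) - centralTrinomial (p ^ (a - 1)))
        / (p : ℚ) ^ (2 * a) : ℚ) : ℚ_[p])‖ ≤ 1 ∧
    ‖((((centralTrinomial (p ^ a) : ℚ) - centralTrinomial (p ^ (a - 1))) / (p : ℚ) ^ (2 * a)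
        - 1 / 6 * ((legendreSym 3 p : ℚ)) ^ a
            * (Polynomial.bernoulli (p - 2)).eval (1 / 3 : ℚ) : ℚ) : ℚ_[p])‖
      ≤ ((p : ℝ))⁻¹ := by
  obtain ⟨a, rfl⟩ : ∃ b, a = b + 1 := ⟨a - 1, by omega⟩
  rw [Nat.add_sub_cancel]
  obtain ⟨hZ, hZQ, hZc⟩ := hQ_lift p
  obtain ⟨τ, hτ, hT⟩ := main_expansion p hp3 a hZ hZQ
  obtain ⟨β, hβ, b, hb, hb1, hb2⟩ := bernZ p hp3
  have hmid := coeff_mid p hp3 a hZ hZc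
  have hfin := sumFinal p hp3 b _ hb hb1 hb2 (p ^ (a + 1)) (by push_cast; simp) _
    (legendre_pow p hp3 (a + 1))
  set c := coeff (p ^ (a + 1)) (FP ℤ_[p] p ^ (p ^ a) * hZ ^ 2) with hc
  set ε := legendreSym 3 p with hε
  have hp0 : (p : ℚ_[p]) ≠ 0 := by exact_mod_cast hp.1.ne_zero
  have hpR : (0 : ℝ) < p := by exact_mod_cast hp.1.pos
  have hpinv : ((p : ℝ))⁻¹ ≤ 1 := inv_le_one_of_one_le₀ (by exact_mod_cast hp.1.one_le)
  have hsm : ∀ k : ℕ, k.Coprime p → ‖(k : ℚ_[p])‖ = 1 := fun k hk => by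
    rw [Padic.norm_natCast_eq_one_iff]; exact hk.symm
  have hc2 : Nat.Coprime 2 p := by
    rw [Nat.coprime_primes Nat.prime_two hp.1]; omega
  have hc3 : Nat.Coprime 3 p := by
    rw [Nat.coprime_primes Nat.prime_three hp.1]; omega
  have n2 : ‖(2 : ℚ_[p])‖ = 1 := by exact_mod_cast hsm 2 hc2
  have n6 : ‖(6 : ℚ_[p])‖ = 1 := by exact_mod_cast hsm 6 (Nat.Coprime.mul_left hc2 hc3)
  set τ' := τ / (p : ℚ_[p]) ^ (2 * (a + 1)) with hτ'
  have hτn : ‖τ'‖ ≤ ((p : ℝ))⁻¹ := by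
    rw [hτ', norm_div, norm_pow, Padic.norm_p, div_le_iff₀ (by positivity), ← pow_succ']
    exact hτ
  have hQe : ((((centralTrinomial (p ^ (a + 1)) : ℚ) - centralTrinomial (p ^ a))
        / (p : ℚ) ^ (2 * (a + 1)) : ℚ) : ℚ_[p]) = (c : ℚ_[p]) / 2 + τ' := by
    push_cast
    rw [hT, hτ']
    field_simp
  refine ⟨?_, ?_⟩
  · rw [hQe]
    refine (Padic.nonarchimedean _ _).trans (max_le ?_ (hτn.trans hpinv))
    rw [norm_div, n2, div_one]
    exact PadicInt.norm_le_one c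
  · rw [Rat.cast_sub, hQe, Rat.cast_mul, ← hβ]
    have e : (c : ℚ_[p]) / 2 + τ' - ((1 / 6 * (ε : ℚ) ^ (a + 1) : ℚ) : ℚ_[p]) * (β : ℚ_[p]) =
        ((3 * c - ((ε ^ (a + 1) : ℤ) : ℤ_[p]) * β : ℤ_[p]) : ℚ_[p]) / 6 + τ' := by
      have h3 : ((3 : ℤ_[p]) : ℚ_[p]) = 3 := map_ofNat PadicInt.Coe.ringHom 3
      push_cast [h3]
      ring
    rw [e]
    refine (Padic.nonarchimedean _ _).trans (max_le ?_ hτn)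
    rw [norm_div, n6, div_one]
    have hz : PadicInt.toZMod (3 * c - ((ε ^ (a + 1) : ℤ) : ℤ_[p]) * β) = 0 := by
      rw [map_sub, map_mul, map_mul, map_intCast, map_ofNat, hmid]
      linear_combination -hfin
    have hmem : (3 * c - ((ε ^ (a + 1) : ℤ) : ℤ_[p]) * β) ∈ Ideal.span {(p : ℤ_[p]) ^ 1} := by
      rw [pow_one, ← PadicInt.maximalIdeal_eq_span_p, ← PadicInt.ker_toZMod]
      exact hz
    have := (PadicInt.norm_le_pow_iff_mem_span_pow _ 1).2 hmem
    rw [← PadicInt.norm_def]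
    refine this.trans (le_of_eq ?_)
    simp
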